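/- arXiv:math/9810032 — 7 statements merged into one kernel-verified Lean document; each statement's English description precedes it below -/
import Mathlib

section
/- Let G be a group, H a normal subgroup of G such that the quotient group Q = G/H is commutative and has no subgroup of index 2. Let ρ : G → SU(2) be a group homomorphism whose induced action on ℂ² is irreducible (the only ρ(G)-invariant ℂ-subspaces of ℂ² are 0 and ℂ²). Then the restriction of ρ to H is also irreducible: the only subspaces of ℂ² invariant under ρ(h) for all h ∈ H are 0 and ℂ². -/
/-- A subgroup in which all "quotients" of outside elements lie has index at most two. -/
theorem Subgroup.eq_top_of_index_ne_two {G : Type*} [Group G] {S : Subgroup G}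
    (hS : S.index ≠ 2) (h : ∀ b c : G, b ∉ S → c ∉ S → b⁻¹ * c ∈ S) : S = ⊤ := by
  by_contra hne
  obtain ⟨a, ha⟩ : ∃ a, a ∉ S := by
    by_contra! hall
    exact hne ((Subgroup.eq_top_iff' S).2 hall)
  refine hS (Subgroup.index_eq_two_iff.2 ⟨a, fun b => ?_⟩)
  by_cases hb : b ∈ S
  · exact Or.inr ⟨hb, fun hba => ha ((S.mul_mem_cancel_left hb).1 hba)⟩
  · refine Or.inl ⟨?_, hb⟩
    simpa using h b⁻¹ a (by simpa using hb) ha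

/-- The stabilizer of the line spanned by a vector under a representation. -/
def Representation.lineStabilizer {k G V : Type*} [Field k] [Group G] [AddCommGroup V]
    [Module k V] (φ : Representation k G V) (v : V) : Subgroup G where
  carrier := {g | ∃ c : k, c ≠ 0 ∧ φ g v = c • v}
  one_mem' := ⟨1, one_ne_zero, by simp⟩
  mul_mem' := by
    rintro a b ⟨c, hc, ha⟩ ⟨d, hd, hb⟩
    exact ⟨d * c, mul_ne_zero hd hc, by simp [ha, hb, mul_smul]⟩
  inv_mem' := by
    rintro a ⟨c, hc, ha⟩
    refine ⟨c⁻¹, inv_ne_zero hc, ?_⟩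
    rw [eq_inv_smul_iff₀ hc, ← map_smul, ← ha, φ.inv_self_apply]

theorem Representation.mem_lineStabilizer_iff {k G V : Type*} [Field k] [Group G]
    [AddCommGroup V] [Module k V] (φ : Representation k G V) {v : V} (hv : v ≠ 0) {g : G} :
    g ∈ φ.lineStabilizer v ↔ ∃ c : k, φ g v = c • v := by
  refine ⟨fun ⟨c, _, h⟩ => ⟨c, h⟩, fun ⟨c, h⟩ => ⟨c, ?_, h⟩⟩
  rintro rfl
  rw [zero_smul] at h
  exact hv (by rw [← φ.inv_self_apply g v, h, map_zero])

/-- In a two-dimensional representation, a pair of elements that commutes up to a scalar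
commutes up to sign. -/
theorem Representation.commute_or_anticommute {k G V : Type*} [Field k] [Group G]
    [AddCommGroup V] [Module k V] (φ : Representation k G V) (hV : Module.finrank k V = 2)
    {a b : G} {c : k} (h : φ a * φ b = c • (φ b * φ a)) :
    φ a * φ b = φ b * φ a ∨ φ a * φ b = -(φ b * φ a) := by
  have hdet : ∀ g, LinearMap.det (φ g) ≠ 0 := fun g => by
    have : IsUnit (LinearMap.det (φ g)) :=
      ((Group.isUnit g).map φ).map LinearMap.det
    exact this.ne_zero
  have hc : c ^ 2 = 1 := by
    have h' := congrArg LinearMap.det h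
    rw [LinearMap.det_smul, hV, map_mul, map_mul, mul_comm (LinearMap.det (φ b))] at h'
    exact (mul_eq_right₀ (mul_ne_zero (hdet a) (hdet b))).1 h'.symm
  rcases mul_self_eq_one_iff.1 ((sq c).symm.trans hc) with rfl | rfl
  · left; simpa using h
  · right; simpa using h

/-- In an irreducible two-dimensional representation of `G`, if a normal subgroup `H` contains all
commutators and is contained in no subgroup of index two, then every common eigenvector of `H`
is a common eigenvector of `G`. (Such an eigenvector therefore cannot exist.) -/
theorem Representation.lineStabilizer_eq_top {k G V : Type*} [Field k] [IsAlgClosed k] [Group G]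
    [AddCommGroup V] [Module k V] (φ : Representation k G V) (hV : Module.finrank k V = 2)
    {H : Subgroup G} [hH : H.Normal] (hcomm : ∀ a b : G, a * b * a⁻¹ * b⁻¹ ∈ H)
    (hindex : ∀ S : Subgroup G, H ≤ S → S.index ≠ 2)
    (hirr : ∀ W : Submodule k V, (∀ g, ∀ x ∈ W, φ g x ∈ W) → W = ⊥ ∨ W = ⊤)
    {v : V} (hv : v ≠ 0) (hHv : H ≤ φ.lineStabilizer v) : φ.lineStabilizer v = ⊤ := by
  have : FiniteDimensional k V := FiniteDimensional.of_finrank_pos (by omega)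
  have : Nontrivial V := ⟨v, 0, hv⟩
  have heig : ∀ g : G, ∀ h ∈ H, ∃ c : k, φ h (φ g v) = c • φ g v := by
    intro g h hh
    obtain ⟨c, -, hc⟩ := hHv (hH.conj_mem' h hh g)
    refine ⟨c, ?_⟩
    rw [← map_smul, ← hc, ← Module.End.mul_apply, ← Module.End.mul_apply, ← map_mul, ← map_mul]
    congr 2
    group
  by_contra hne
  obtain ⟨g₀, hg₀⟩ : ∃ g, g ∉ φ.lineStabilizer v := by
    by_contra! hall
    exact hne ((Subgroup.eq_top_iff' _).2 hall)
  have hli : LinearIndependent k ![v, φ g₀ v] := by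
    rw [LinearIndependent.pair_iff' hv]
    exact fun c hc => hg₀ ((φ.mem_lineStabilizer_iff hv).2 ⟨c, hc.symm⟩)
  have hspan : ∀ x : V, ∃ a b : k, a • v + b • φ g₀ v = x := by
    intro x
    have htop := hli.span_eq_top_of_card_eq_finrank' (by simp [hV])
    rw [Matrix.range_cons_cons_empty] at htop
    exact Submodule.mem_span_pair.1 (htop ▸ Submodule.mem_top)
  by_cases hscalar : ∀ h ∈ H, ∃ c : k, φ h = c • 1
  · have hsign : ∀ a b : G, φ a * φ b = φ b * φ a ∨ φ a * φ b = -(φ b * φ a) := by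
      intro a b
      obtain ⟨c, hc⟩ := hscalar _ (hcomm a b)
      refine φ.commute_or_anticommute hV (c := c) ?_
      rw [← one_mul (φ b * φ a), ← smul_mul_assoc, ← hc, ← map_mul, ← map_mul, ← map_mul]
      congr 1
      group
    have hcommute : ∀ a b : G, φ b * φ a = φ a * φ b := by
      intro a
      let S : Subgroup G :=
        (Subgroup.centralizer {φ.asGroupHom a}).comap φ.asGroupHom
      have hmem : ∀ b, b ∈ S ↔ φ b * φ a = φ a * φ b := by
        intro b
        simp only [S, Subgroup.mem_comap, Subgroup.mem_centralizer_singleton_iff, Units.ext_iff,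
          Units.val_mul, Representation.asGroupHom_apply]
      have hS : S = ⊤ := by
        refine Subgroup.eq_top_of_index_ne_two (hindex S fun h hh => ?_) fun b c hb hc => ?_
        · obtain ⟨c, hc⟩ := hscalar h hh
          rw [hmem, hc]
          simp
        · rw [hmem] at hb hc
          have hb' := (hsign b a).resolve_left hb
          have hc' := (hsign c a).resolve_left hc
          have hbb : φ b⁻¹ * φ b = 1 := by rw [← map_mul]; simp
          have hbb' : φ b * φ b⁻¹ = 1 := by rw [← map_mul]; simp
          have hinv : φ b⁻¹ * φ a = -(φ a * φ b⁻¹) := by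
            calc φ b⁻¹ * φ a = φ b⁻¹ * (φ a * φ b) * φ b⁻¹ := by
                  rw [mul_assoc, mul_assoc, hbb', mul_one]
              _ = -(φ a * φ b⁻¹) := by
                  rw [← neg_eq_iff_eq_neg.2 hb', mul_neg, ← mul_assoc, hbb, one_mul, neg_mul]
          rw [hmem, map_mul, mul_assoc, hc', mul_neg, ← mul_assoc, hinv, neg_mul, neg_neg,
            mul_assoc]
      exact fun b => (hmem b).1 (hS ▸ Subgroup.mem_top b)
    obtain ⟨μ, hμ⟩ := Module.End.exists_eigenvalue (φ g₀)
    rcases hirr (Module.End.eigenspace (φ g₀) μ) (fun g x hx => by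
      rw [Module.End.mem_eigenspace_iff] at hx ⊢
      rw [← Module.End.mul_apply, hcommute, Module.End.mul_apply, hx, map_smul]) with hbot | htop
    · exact hμ hbot
    · have hvμ : v ∈ Module.End.eigenspace (φ g₀) μ := htop ▸ Submodule.mem_top
      exact hg₀ ((φ.mem_lineStabilizer_iff hv).2 ⟨μ, Module.End.mem_eigenspace_iff.1 hvμ⟩)
  · push Not at hscalar
    obtain ⟨h, hh, hns⟩ := hscalar
    obtain ⟨χ, -, hχ⟩ := hHv hh
    obtain ⟨ψ, hψ⟩ := heig g₀ h hh
    have hχψ : χ ≠ ψ := by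
      rintro rfl
      refine hns χ (LinearMap.ext fun x => ?_)
      obtain ⟨a, b, rfl⟩ := hspan x
      simp [hχ, hψ, smul_comm χ]
    have hline : ∀ g, g ∉ φ.lineStabilizer v → ∃ b : k, φ g v = b • φ g₀ v := by
      intro g hg
      obtain ⟨μ, hμ⟩ := heig g h hh
      obtain ⟨a, b, hab⟩ := hspan (φ g v)
      rw [← hab, map_add, map_smul, map_smul, hχ, hψ] at hμ
      have hz : (a * (χ - μ)) • v + (b * (ψ - μ)) • φ g₀ v = 0 := by
        rw [← sub_eq_zero.2 hμ]
        module
      obtain ⟨h₁, h₂⟩ := LinearIndependent.pair_iff.1 hli _ _ hz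
      have hb : b ≠ 0 := by
        rintro rfl
        exact hg ((φ.mem_lineStabilizer_iff hv).2 ⟨a, by simpa using hab.symm⟩)
      have hψμ : ψ = μ := sub_eq_zero.1 ((mul_eq_zero.1 h₂).resolve_left hb)
      have ha : a = 0 :=
        (mul_eq_zero.1 h₁).resolve_right (sub_ne_zero.2 (hψμ ▸ hχψ))
      exact ⟨b, by rw [← hab, ha, zero_smul, zero_add]⟩
    refine hne (Subgroup.eq_top_of_index_ne_two (hindex _ hHv) fun b c hb hc => ?_)
    obtain ⟨β, hβ⟩ := hline b hb
    obtain ⟨γ, hγ⟩ := hline c hc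
    have hβ0 : β ≠ 0 := by
      rintro rfl
      rw [zero_smul] at hβ
      exact hv (by rw [← φ.inv_self_apply b v, hβ, map_zero])
    refine (φ.mem_lineStabilizer_iff hv).2 ⟨γ * β⁻¹, ?_⟩
    rw [map_mul, Module.End.mul_apply, hγ, mul_smul, map_smul,
      (eq_inv_smul_iff₀ hβ0).2 hβ.symm, map_smul, φ.inv_self_apply]


/-- Lemma 2.5 (group theory lemma): if `H ◁ G` with `G/H` abelian and having no
subgroup of index 2, then any irreducible `SU(2)` representation of `G`
restricts to an irreducible representation of `H`. -/
theorem stmt0 (G : Type*) [Group G] (H : Subgroup G) [H.Normal]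
    (hQcomm : ∀ a b : G ⧸ H, a * b = b * a)
    (hQno2 : ∀ K : Subgroup (G ⧸ H), K.index ≠ 2)
    (ρ : G →* Matrix.specialUnitaryGroup (Fin 2) ℂ)
    (hirr : ∀ W : Submodule ℂ (Fin 2 → ℂ),
      (∀ g : G, ∀ v ∈ W, Matrix.mulVec (ρ g : Matrix (Fin 2) (Fin 2) ℂ) v ∈ W) →
      W = ⊥ ∨ W = ⊤) :
    ∀ W : Submodule ℂ (Fin 2 → ℂ),
      (∀ h : H, ∀ v ∈ W, Matrix.mulVec (ρ (h : G) : Matrix (Fin 2) (Fin 2) ℂ) v ∈ W) →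
      W = ⊥ ∨ W = ⊤ := by
  have hcomm : ∀ a b : G, a * b * a⁻¹ * b⁻¹ ∈ H := by
    intro a b
    rw [← QuotientGroup.eq_one_iff]
    simp only [QuotientGroup.mk_mul, QuotientGroup.mk_inv]
    rw [hQcomm (a : G ⧸ H) b]
    group
  have hindex : ∀ S : Subgroup G, H ≤ S → S.index ≠ 2 := by
    intro S hS h2
    refine hQno2 (S.map (QuotientGroup.mk' H)) ?_
    rw [Subgroup.index_map_eq S (QuotientGroup.mk'_surjective H) (by simpa using hS), h2]
  let φ : Representation ℂ G (Fin 2 → ℂ) :=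
    (Matrix.toLinAlgEquiv' : Matrix (Fin 2) (Fin 2) ℂ ≃ₐ[ℂ] _).toMonoidHom.comp
      ((Matrix.specialUnitaryGroup (Fin 2) ℂ).subtype.comp ρ)
  have hφ : ∀ g x, φ g x = Matrix.mulVec (ρ g : Matrix (Fin 2) (Fin 2) ℂ) x := fun _ _ => rfl
  have hV : Module.finrank ℂ (Fin 2 → ℂ) = 2 := by simp
  intro W hW
  by_contra! hne
  obtain ⟨hbot, htop⟩ := hne
  obtain ⟨v, hvW, hv⟩ := W.exists_mem_ne_zero_of_ne_bot hbot
  have hW1 : Module.finrank ℂ W = 1 := by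
    have := Submodule.finrank_lt htop
    have := Submodule.one_le_finrank_iff.2 hbot
    omega
  have hline : ∀ x ∈ W, ∃ c : ℂ, c • v = x := by
    intro x hx
    obtain ⟨c, hc⟩ := (finrank_eq_one_iff_of_nonzero' (⟨v, hvW⟩ : W)
      (by simpa [Subtype.ext_iff] using hv)).1 hW1 ⟨x, hx⟩
    exact ⟨c, congrArg Subtype.val hc⟩
  have hHv : H ≤ φ.lineStabilizer v := fun h hh => by
    obtain ⟨c, hc⟩ := hline _ (hW ⟨h, hh⟩ v hvW)
    exact (φ.mem_lineStabilizer_iff hv).2 ⟨c, hc.symm⟩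
  have hall := φ.lineStabilizer_eq_top hV hcomm hindex hirr hv hHv
  have := hirr W fun g x hx => by
    obtain ⟨a, rfl⟩ := hline x hx
    obtain ⟨c, -, hc⟩ : g ∈ φ.lineStabilizer v := hall ▸ Subgroup.mem_top g
    rw [Matrix.mulVec_smul, ← hφ, hc]
    exact W.smul_mem _ (W.smul_mem _ hvW)
  exact this.elim hbot htop
end

section
/- Fix a real number β > 1. There exists a constant C(β) > 0, independent of γ, such that for every real γ > 0 the infinite product ∏_{j=0}^∞ (1 + γ β^{2j}/(2β^{j} − 1))^{1/β^{j}} converges and satisfies ∏_{j=0}^∞ (1 + γ β^{2j}/(2β^{j} − 1))^{1/β^{j}} ≤ C(β) (1 + γ^{β/(β−1)}). -/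
lemma one_add_mul_div_le {β γ : ℝ} (hβ : 1 < β) (hγ : 0 < γ) (j : ℕ) :
    1 + γ * β ^ (2 * j) / (2 * β ^ j - 1) ≤ (1 + γ) * β ^ j := by
  have hb : 1 ≤ β ^ j := one_le_pow₀ hβ.le
  have h : γ * β ^ (2 * j) / (2 * β ^ j - 1) ≤ γ * β ^ j := by
    rw [div_le_iff₀ (by linarith), mul_comm 2 j, pow_mul]
    nlinarith [mul_nonneg (mul_nonneg hγ.le (by linarith : 0 ≤ β ^ j)) (sub_nonneg.2 hb)]
  linarith

lemma one_le_one_add_mul_div {β γ : ℝ} (hβ : 1 < β) (hγ : 0 < γ) (j : ℕ) :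
    1 ≤ 1 + γ * β ^ (2 * j) / (2 * β ^ j - 1) := by
  have hb : 1 ≤ β ^ j := one_le_pow₀ hβ.le
  have h : 0 ≤ γ * β ^ (2 * j) / (2 * β ^ j - 1) :=
    div_nonneg (by positivity) (by linarith)
  linarith

lemma one_add_rpow_le {γ s : ℝ} (hγ : 0 < γ) (hs : 0 ≤ s) :
    (1 + γ) ^ s ≤ 2 ^ s * (1 + γ ^ s) := by
  have hp : 0 ≤ γ ^ s := by positivity
  rcases le_total γ 1 with h | h
  · calc (1 + γ) ^ s ≤ 2 ^ s := Real.rpow_le_rpow (by linarith) (by linarith) hs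
      _ ≤ 2 ^ s * (1 + γ ^ s) := le_mul_of_one_le_right (by positivity) (by linarith)
  · calc (1 + γ) ^ s ≤ (2 * γ) ^ s := Real.rpow_le_rpow (by linarith) (by linarith) hs
      _ = 2 ^ s * γ ^ s := Real.mul_rpow (by norm_num) hγ.le
      _ ≤ 2 ^ s * (1 + γ ^ s) := by gcongr; linarith

/-- Lemma 4.5: for `β > 1` there is a constant `C(β) > 0`, independent of `γ`, such that
`∏_{j=0}^∞ (1 + γ β^{2j}/(2β^j − 1))^{1/β^j} ≤ C(β)(1 + γ^{β/(β−1)})` for all `γ > 0`. -/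
theorem stmt2 (β : ℝ) (hβ : 1 < β) :
    ∃ C : ℝ, 0 < C ∧ ∀ γ : ℝ, 0 < γ →
      Multipliable (fun j : ℕ => (1 + γ * β ^ (2 * j) / (2 * β ^ j - 1)) ^ ((1 : ℝ) / β ^ j)) ∧
      (∏' j : ℕ, (1 + γ * β ^ (2 * j) / (2 * β ^ j - 1)) ^ ((1 : ℝ) / β ^ j)) ≤
        C * (1 + γ ^ (β / (β - 1))) := by
  have hβ0 : 0 < β := by linarith
  have hr0 : 0 ≤ β⁻¹ := by positivity
  have hr1 : β⁻¹ < 1 := inv_lt_one_of_one_lt₀ hβ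
  have hgeom : HasSum (fun j : ℕ => β⁻¹ ^ j) (β / (β - 1)) := by
    have h := hasSum_geometric_of_lt_one hr0 hr1
    have he : (1 - β⁻¹)⁻¹ = β / (β - 1) := by
      rw [← inv_div, sub_div, div_self hβ0.ne', one_div]
    rwa [he] at h
  obtain ⟨K, hK⟩ : Summable (fun j : ℕ => (j : ℝ) * β⁻¹ ^ j) := by
    simpa using summable_pow_mul_geometric_of_norm_lt_one 1
      (by rwa [Real.norm_of_nonneg hr0] : ‖β⁻¹‖ < 1)
  refine ⟨Real.exp (K * Real.log β) * 2 ^ (β / (β - 1)), by positivity, fun γ hγ => ?_⟩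
  have hone := one_le_one_add_mul_div hβ hγ
  have hpos : ∀ j : ℕ, 0 < (1 + γ * β ^ (2 * j) / (2 * β ^ j - 1)) ^ ((1 : ℝ) / β ^ j) :=
    fun j => Real.rpow_pos_of_pos (by linarith [hone j]) _
  have hlog : ∀ j : ℕ,
      Real.log ((1 + γ * β ^ (2 * j) / (2 * β ^ j - 1)) ^ ((1 : ℝ) / β ^ j)) =
        β⁻¹ ^ j * Real.log (1 + γ * β ^ (2 * j) / (2 * β ^ j - 1)) := fun j => by
    rw [Real.log_rpow (by linarith [hone j]), one_div, inv_pow]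
  have hle : ∀ j : ℕ,
      Real.log ((1 + γ * β ^ (2 * j) / (2 * β ^ j - 1)) ^ ((1 : ℝ) / β ^ j)) ≤
        β⁻¹ ^ j * Real.log (1 + γ) + j * β⁻¹ ^ j * Real.log β := fun j => by
    have h := Real.log_le_log (by linarith [hone j]) (one_add_mul_div_le hβ hγ j)
    rw [Real.log_mul (by linarith) (by positivity), Real.log_pow] at h
    rw [hlog]
    calc _ ≤ β⁻¹ ^ j * (Real.log (1 + γ) + j * Real.log β) := by gcongr
      _ = _ := by ring
  have hbound := (hgeom.mul_right (Real.log (1 + γ))).add (hK.mul_right (Real.log β))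
  have hsum : Summable fun j : ℕ =>
      Real.log ((1 + γ * β ^ (2 * j) / (2 * β ^ j - 1)) ^ ((1 : ℝ) / β ^ j)) :=
    hbound.summable.of_nonneg_of_le
      (fun j => by rw [hlog]; exact mul_nonneg (by positivity) (Real.log_nonneg (hone j))) hle
  refine ⟨Real.multipliable_of_summable_log hpos hsum, ?_⟩
  rw [← Real.rexp_tsum_eq_tprod hpos hsum]
  calc _ ≤ Real.exp (β / (β - 1) * Real.log (1 + γ) + K * Real.log β) :=
        Real.exp_le_exp.2 (hasSum_le hle hsum.hasSum hbound)
    _ = Real.exp (K * Real.log β) * (1 + γ) ^ (β / (β - 1)) := by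
        rw [Real.rpow_def_of_pos (by linarith), ← Real.exp_add]
        ring_nf
    _ ≤ Real.exp (K * Real.log β) * (2 ^ (β / (β - 1)) * (1 + γ ^ (β / (β - 1)))) := by
        gcongr
        exact one_add_rpow_le hγ (div_nonneg hβ0.le (by linarith))
    _ = _ := by ring
end

section
/- There is a universal constant C > 0 with the following property (Moser iteration for the closed/Neumann case). Let a > 0, s > 0, λ ≥ 0 be real numbers and let (N_k)_{k≥0} be a sequence of nonnegative real numbers such that for every k ≥ 0, N_{k+1} ≤ (a^{−1/2} + (2^{2k}/(2^{k+1} − 1)) · (4λ a^{1/2}/s))^{1/2^{k+1}} · N_k. Then limsup_{k→∞} N_k² ≤ C (a^{−1} + (4λ/s)² a) N_0². -/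
open Filter Topology in
/-- The limsup of `u²` is controlled when each step multiplies `u` by at most
`(2 ^ k * D) ^ (1 / 2 ^ (k + 1))`. -/
theorem limsup_sq_le_of_le_rpow_mul {D : ℝ} (hD : 0 < D) {u : ℕ → ℝ} (hu : ∀ k, 0 ≤ u k)
    (h : ∀ k : ℕ, u (k + 1) ≤ ((2 : ℝ) ^ k * D) ^ ((1 : ℝ) / 2 ^ (k + 1)) * u k) :
    limsup (fun k => u k ^ 2) atTop ≤ 4 * D ^ 2 * u 0 ^ 2 := by
  have key : ∀ n : ℕ, u n ≤
      (2 : ℝ) ^ ((1 : ℝ) - (n + 1) / 2 ^ n) * D ^ ((1 : ℝ) - 1 / 2 ^ n) * u 0 := by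
    intro n
    induction n with
    | zero => simp
    | succ n ih =>
      refine (h n).trans ((mul_le_mul_of_nonneg_left ih (by positivity)).trans_eq ?_)
      rw [Real.mul_rpow (by positivity) hD.le, ← Real.rpow_natCast_mul zero_le_two]
      have e1 : (1 : ℝ) - ((n + 1 : ℕ) + 1) / 2 ^ (n + 1)
          = (n : ℝ) * (1 / 2 ^ (n + 1)) + (1 - (n + 1) / 2 ^ n) := by
        push_cast
        field_simp
        ring
      have e2 : (1 : ℝ) - 1 / 2 ^ (n + 1) = 1 / 2 ^ (n + 1) + (1 - 1 / 2 ^ n) := by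
        field_simp
        ring
      rw [e1, e2, Real.rpow_add two_pos, Real.rpow_add hD]
      ring
  have bound : ∀ n : ℕ, u n ^ 2 ≤ (2 * D ^ ((1 : ℝ) - 1 / 2 ^ n) * u 0) ^ 2 := by
    intro n
    refine pow_le_pow_left₀ (hu n) ((key n).trans ?_) 2
    have h2 : (2 : ℝ) ^ ((1 : ℝ) - (n + 1) / 2 ^ n) ≤ 2 := by
      refine (Real.rpow_le_rpow_of_exponent_le one_le_two (?_ : _ ≤ (1 : ℝ))).trans_eq
        (Real.rpow_one 2)
      exact sub_le_self _ (by positivity)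
    have := hu 0
    gcongr
  have lim : Tendsto (fun n : ℕ => (2 * D ^ ((1 : ℝ) - 1 / 2 ^ n) * u 0) ^ 2) atTop
      (𝓝 (4 * D ^ 2 * u 0 ^ 2)) := by
    have t1 : Tendsto (fun n : ℕ => (1 : ℝ) - 1 / 2 ^ n) atTop (𝓝 1) := by
      have t0 := tendsto_pow_atTop_nhds_zero_of_lt_one (r := (1 / 2 : ℝ)) (by norm_num) (by norm_num)
      simpa [div_eq_mul_inv] using t0.const_sub 1
    have t2 := ((((Real.continuousAt_const_rpow hD.ne').tendsto.comp t1).const_mul 2).mul_const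
      (u 0)).pow 2
    have e : (2 * D ^ (1 : ℝ) * u 0) ^ 2 = 4 * D ^ 2 * u 0 ^ 2 := by
      rw [Real.rpow_one]
      ring
    exact e ▸ t2
  rw [← lim.limsup_eq]
  exact limsup_le_limsup (Eventually.of_forall bound)
    (isCoboundedUnder_le_of_le atTop (x := 0) fun n => sq_nonneg (u n)) lim.isBoundedUnder_le


/-- Moser iteration, closed/Neumann case: if `N_{k+1} ≤
(a^{-1/2} + (2^{2k}/(2^{k+1}-1))(4λa^{1/2}/s))^{1/2^{k+1}} N_k` for all `k`, then
`limsup N_k² ≤ C (a⁻¹ + (4λ/s)² a) N_0²` for a universal constant `C`. -/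
theorem stmt3 :
    ∃ C : ℝ, 0 < C ∧
      ∀ (a s lam : ℝ) (N : ℕ → ℝ), 0 < a → 0 < s → 0 ≤ lam →
        (∀ k : ℕ, 0 ≤ N k) →
        (∀ k : ℕ, N (k + 1) ≤
          (a ^ (-(1 : ℝ) / 2) +
              ((2 : ℝ) ^ (2 * k) / ((2 : ℝ) ^ (k + 1) - 1)) *
                (4 * lam * a ^ ((1 : ℝ) / 2) / s)) ^
              ((1 : ℝ) / 2 ^ (k + 1)) * N k) →
        Filter.limsup (fun k : ℕ => (N k) ^ 2) Filter.atTop ≤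
          C * (a⁻¹ + (4 * lam / s) ^ 2 * a) * (N 0) ^ 2 := by
  refine ⟨8, by norm_num, fun a s lam N ha hs hl hN h => ?_⟩
  set M : ℝ := 4 * lam * a ^ ((1 : ℝ) / 2) / s with hM
  set A : ℝ := a ^ (-(1 : ℝ) / 2) with hA
  have hA0 : 0 < A := by positivity
  have hM0 : 0 ≤ M := by positivity
  have hA2 : A ^ 2 = a⁻¹ := by
    rw [hA, ← Real.rpow_natCast, ← Real.rpow_mul ha.le, ← Real.rpow_neg_one]
    norm_num
  have hM2 : M ^ 2 = (4 * lam / s) ^ 2 * a := by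
    have hr : (a ^ ((1 : ℝ) / 2)) ^ 2 = a := by
      rw [← Real.rpow_natCast, ← Real.rpow_mul ha.le]
      norm_num
    rw [hM, div_pow, mul_pow, hr]
    ring
  have step : ∀ k : ℕ,
      N (k + 1) ≤ ((2 : ℝ) ^ k * (A + M)) ^ ((1 : ℝ) / 2 ^ (k + 1)) * N k := by
    intro k
    have h1 : (1 : ℝ) ≤ 2 ^ k := one_le_pow₀ one_le_two
    have hden : (0 : ℝ) < 2 ^ (k + 1) - 1 := by
      rw [pow_succ]
      linarith
    have hq : (2 : ℝ) ^ (2 * k) / (2 ^ (k + 1) - 1) ≤ 2 ^ k := by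
      rw [div_le_iff₀ hden, two_mul, pow_add, pow_succ]
      gcongr
      linarith
    refine (h k).trans (mul_le_mul_of_nonneg_right ?_ (hN k))
    refine Real.rpow_le_rpow (by positivity) ?_ (by positivity)
    rw [mul_add]
    exact add_le_add (le_mul_of_one_le_left hA0.le h1) (mul_le_mul_of_nonneg_right hq hM0)
  refine (limsup_sq_le_of_le_rpow_mul (by positivity) hN step).trans ?_
  rw [← hA2, ← hM2]
  refine mul_le_mul_of_nonneg_right ?_ (sq_nonneg _)
  linarith [sq_nonneg (A - M), add_sq A M, sub_sq A M]
end

section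
/- There is a universal constant C > 0 with the following property (Moser iteration for the Dirichlet case). Let a > 0, s > 0, λ ≥ 0 be real numbers and let (N_k)_{k≥0} be a sequence of nonnegative real numbers such that for every k ≥ 0, N_{k+1} ≤ ((2^{2k}/(2^{k+1} − 1)) · (4λ a^{1/2}/s))^{1/2^{k+1}} · N_k. Then limsup_{k→∞} N_k² ≤ C (4λ/s)² a N_0². -/
/-- The Moser iteration factor is at most `2 ^ (k / 2 ^ (k + 1)) * B ^ (1 / 2 ^ (k + 1))`. -/
lemma moser_factor_le {B : ℝ} (hB : 0 ≤ B) (k : ℕ) :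
    (((2 : ℝ) ^ (2 * k) / ((2 : ℝ) ^ (k + 1) - 1)) * B) ^ ((1 : ℝ) / 2 ^ (k + 1)) ≤
      (2 : ℝ) ^ ((k : ℝ) / 2 ^ (k + 1)) * B ^ ((1 : ℝ) / 2 ^ (k + 1)) := by
  have h1 : (1 : ℝ) ≤ 2 ^ k := one_le_pow₀ (by norm_num)
  have hpos : (0 : ℝ) < 2 ^ (k + 1) - 1 := by rw [pow_succ]; linarith
  have hc : (2 : ℝ) ^ (2 * k) / ((2 : ℝ) ^ (k + 1) - 1) ≤ 2 ^ k := by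
    rw [div_le_iff₀ hpos, pow_succ, two_mul, pow_add]
    nlinarith
  calc _ ≤ ((2 : ℝ) ^ k * B) ^ ((1 : ℝ) / 2 ^ (k + 1)) := by gcongr
    _ = _ := by
      rw [Real.mul_rpow (by positivity) hB, ← Real.rpow_natCast 2 k,
        ← Real.rpow_mul (by norm_num), mul_one_div]

/-- Iterating the Moser estimate `k` times. -/
lemma moser_iterate_le {B : ℝ} (hB : 0 ≤ B) {N : ℕ → ℝ} (hN : ∀ k, 0 ≤ N k)
    (h : ∀ k : ℕ, N (k + 1) ≤
      (((2 : ℝ) ^ (2 * k) / ((2 : ℝ) ^ (k + 1) - 1)) * B) ^ ((1 : ℝ) / 2 ^ (k + 1)) * N k)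
    (k : ℕ) :
    N k ≤ (2 : ℝ) ^ (1 - ((k : ℝ) + 1) / 2 ^ k) * B ^ (1 - (1 : ℝ) / 2 ^ k) * N 0 := by
  induction k with
  | zero => simp
  | succ k ih =>
    have hle : (1 : ℝ) / 2 ^ k ≤ 1 :=
      div_le_one_of_le₀ (one_le_pow₀ (by norm_num)) (by positivity)
    have e2 : 1 - (((k + 1 : ℕ) : ℝ) + 1) / 2 ^ (k + 1) =
        (k : ℝ) / 2 ^ (k + 1) + (1 - ((k : ℝ) + 1) / 2 ^ k) := by
      push_cast
      field_simp
      ring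
    have eB : 1 - (1 : ℝ) / 2 ^ (k + 1) = 1 / 2 ^ (k + 1) + (1 - 1 / 2 ^ k) := by
      field_simp
      ring
    rw [e2, eB, Real.rpow_add (by norm_num),
      Real.rpow_add_of_nonneg hB (by positivity) (by linarith)]
    calc N (k + 1) ≤ _ := h k
      _ ≤ ((2 : ℝ) ^ ((k : ℝ) / 2 ^ (k + 1)) * B ^ ((1 : ℝ) / 2 ^ (k + 1))) *
          ((2 : ℝ) ^ (1 - ((k : ℝ) + 1) / 2 ^ k) * B ^ (1 - (1 : ℝ) / 2 ^ k) * N 0) :=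
        mul_le_mul (moser_factor_le hB k) ih (hN k) (by positivity)
      _ = _ := by ring


/-- Moser iteration, Dirichlet case: if `N_{k+1} ≤
((2^{2k}/(2^{k+1}-1))(4λa^{1/2}/s))^{1/2^{k+1}} N_k` for all `k`, then
`limsup N_k² ≤ C (4λ/s)² a N_0²` for a universal constant `C`. -/
theorem stmt4 :
    ∃ C : ℝ, 0 < C ∧
      ∀ (a s lam : ℝ) (N : ℕ → ℝ), 0 < a → 0 < s → 0 ≤ lam →
        (∀ k : ℕ, 0 ≤ N k) →
        (∀ k : ℕ, N (k + 1) ≤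
          (((2 : ℝ) ^ (2 * k) / ((2 : ℝ) ^ (k + 1) - 1)) *
              (4 * lam * a ^ ((1 : ℝ) / 2) / s)) ^ ((1 : ℝ) / 2 ^ (k + 1)) * N k) →
        Filter.limsup (fun k : ℕ => (N k) ^ 2) Filter.atTop ≤
          C * (4 * lam / s) ^ 2 * a * (N 0) ^ 2 := by
  refine ⟨4, by norm_num, fun a s lam N ha hs hlam hN h => ?_⟩
  set B : ℝ := 4 * lam * a ^ ((1 : ℝ) / 2) / s with hBdef
  have hB : 0 ≤ B := by positivity
  have hBsq : (2 * B * N 0) ^ 2 = 4 * (4 * lam / s) ^ 2 * a * (N 0) ^ 2 := by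
    have hsq : (a ^ ((1 : ℝ) / 2)) ^ 2 = a := by
      rw [← Real.sqrt_eq_rpow, Real.sq_sqrt ha.le]
    calc (2 * B * N 0) ^ 2 =
        4 * (4 * lam / s) ^ 2 * (a ^ ((1 : ℝ) / 2)) ^ 2 * (N 0) ^ 2 := by rw [hBdef]; ring
      _ = _ := by rw [hsq]
  have hbound : ∀ k, (N k) ^ 2 ≤ (2 * B ^ (1 - (1 : ℝ) / 2 ^ k) * N 0) ^ 2 := fun k => by
    have h2 : (2 : ℝ) ^ (1 - ((k : ℝ) + 1) / 2 ^ k) ≤ 2 := by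
      refine (Real.rpow_le_rpow_of_exponent_le (by norm_num) ?_).trans_eq (Real.rpow_one 2)
      have : (0 : ℝ) ≤ ((k : ℝ) + 1) / 2 ^ k := by positivity
      linarith
    have h0 := hN 0
    refine pow_le_pow_left₀ (hN k) ((moser_iterate_le hB hN h k).trans ?_) 2
    gcongr
  have hexp : Filter.Tendsto (fun k : ℕ => 1 - (1 : ℝ) / 2 ^ k) Filter.atTop (nhds 1) := by
    have := (tendsto_pow_atTop_nhds_zero_of_lt_one (r := (1 / 2 : ℝ))
      (by norm_num) (by norm_num)).const_sub 1
    simpa using this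
  have hlim : Filter.Tendsto (fun k : ℕ => (2 * B ^ (1 - (1 : ℝ) / 2 ^ k) * N 0) ^ 2)
      Filter.atTop (nhds ((2 * B * N 0) ^ 2)) := by
    have := (tendsto_const_nhds (x := B)).rpow hexp (Or.inr one_pos)
    rw [Real.rpow_one] at this
    exact ((this.const_mul 2).mul_const (N 0)).pow 2
  rw [← hBsq, ← hlim.limsup_eq]
  exact Filter.limsup_le_limsup (Filter.Eventually.of_forall hbound)
    (Filter.isCoboundedUnder_le_of_le Filter.atTop fun k => sq_nonneg (N k))
    hlim.isBoundedUnder_le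
end

section
/- Fix real numbers κ and ℓ with 0 < κ ≤ 1 and 0 < ℓ ≤ 3/4, and define ε(ℓ) = (ℓ/(1 + √(1 − ℓ))²)^{1/(κ√(1 − ℓ))}. Then ℓ^{2/κ}/16^{1/κ} ≤ ε(ℓ) ≤ ℓ^{1/κ}. -/
/-- For `1/2 ≤ s < 1`, the base `(1-s²)/(1+s)²` raised to `1/s` lies between
`(1-s²)²/16` and `1-s²`. -/
theorem rpow_one_div_bounds {s : ℝ} (hs : 1 / 2 ≤ s) (hs1 : s < 1) :
    (1 - s ^ 2) ^ 2 / 16 ≤ ((1 - s ^ 2) / (1 + s) ^ 2) ^ (1 / s) ∧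
      ((1 - s ^ 2) / (1 + s) ^ 2) ^ (1 / s) ≤ 1 - s ^ 2 := by
  have hs0 : 0 < s := by linarith
  have hl : 0 < 1 - s ^ 2 := by nlinarith
  have hb : (1 - s ^ 2) / (1 + s) ^ 2 = (1 - s) / (1 + s) := by
    field_simp
    ring
  have hB0 : 0 < (1 - s ^ 2) / (1 + s) ^ 2 := by positivity
  have hB1 : (1 - s ^ 2) / (1 + s) ^ 2 ≤ 1 - s := by
    rw [hb]
    exact div_le_self (by linarith) (by linarith)
  constructor
  · calc (1 - s ^ 2) ^ 2 / 16 ≤ ((1 - s ^ 2) / (1 + s) ^ 2) ^ 2 := by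
          rw [div_pow]
          gcongr
          calc ((1 + s) ^ 2) ^ 2 ≤ ((1 + 1) ^ 2) ^ 2 := by gcongr
            _ = 16 := by norm_num
      _ = ((1 - s ^ 2) / (1 + s) ^ 2) ^ (2 : ℝ) := by norm_num
      _ ≤ ((1 - s ^ 2) / (1 + s) ^ 2) ^ (1 / s) := by
          apply Real.rpow_le_rpow_of_exponent_ge hB0 (by linarith)
          rw [div_le_iff₀ hs0]
          linarith
  · have h : (1 - s ^ 2) / (1 + s) ^ 2 ≤ (1 - s ^ 2) ^ s :=
      calc (1 - s ^ 2) / (1 + s) ^ 2 ≤ 1 - s := hB1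
        _ ≤ 1 - s ^ 2 := by nlinarith
        _ ≤ (1 - s ^ 2) ^ s :=
          Real.self_le_rpow_of_le_one hl.le (by nlinarith) hs1.le
    calc ((1 - s ^ 2) / (1 + s) ^ 2) ^ (1 / s) ≤ ((1 - s ^ 2) ^ s) ^ (1 / s) := by gcongr
      _ = 1 - s ^ 2 := by
        rw [← Real.rpow_mul hl.le, mul_one_div_cancel hs0.ne', Real.rpow_one]

/-- Bounds on the plumbing parameter: for `0 < κ ≤ 1` and `0 < ℓ ≤ 3/4`, with
`ε(ℓ) = (ℓ/(1+√(1-ℓ))²)^{1/(κ√(1-ℓ))}` one has `ℓ^{2/κ}/16^{1/κ} ≤ ε(ℓ) ≤ ℓ^{1/κ}`. -/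
theorem stmt7 (κ ℓ : ℝ) (hκ0 : 0 < κ) (hκ1 : κ ≤ 1) (hℓ0 : 0 < ℓ) (hℓ : ℓ ≤ 3 / 4) :
    ℓ ^ (2 / κ) / (16 : ℝ) ^ (1 / κ) ≤
        (ℓ / (1 + Real.sqrt (1 - ℓ)) ^ 2) ^ (1 / (κ * Real.sqrt (1 - ℓ))) ∧
      (ℓ / (1 + Real.sqrt (1 - ℓ)) ^ 2) ^ (1 / (κ * Real.sqrt (1 - ℓ))) ≤ ℓ ^ (1 / κ) := by
  have hs : 1 / 2 ≤ √(1 - ℓ) := Real.le_sqrt_of_sq_le (by linarith)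
  have hs1 : √(1 - ℓ) < 1 := (Real.sqrt_lt' one_pos).2 (by linarith)
  have hsq : 1 - √(1 - ℓ) ^ 2 = ℓ := by
    rw [Real.sq_sqrt (by linarith)]
    ring
  obtain ⟨hlow, hup⟩ := rpow_one_div_bounds hs hs1
  rw [hsq] at hlow hup
  have hexp : 1 / (κ * √(1 - ℓ)) = 1 / √(1 - ℓ) * (1 / κ) := by
    rw [mul_comm κ, one_div_mul_one_div]
  have hleft : ℓ ^ (2 / κ) / (16 : ℝ) ^ (1 / κ) = (ℓ ^ 2 / 16) ^ (1 / κ) := by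
    rw [Real.div_rpow (by positivity) (by norm_num), ← Real.rpow_natCast ℓ 2,
      ← Real.rpow_mul hℓ0.le, Nat.cast_ofNat, mul_one_div]
  rw [hexp, Real.rpow_mul (by positivity), hleft]
  exact ⟨by gcongr, by gcongr⟩
end

section
/- Fix real numbers κ > 0 and ℓ with 0 < ℓ < 1, and define f : ℝ → ℝ by f(x) = ( (√(1−ℓ)/(1 + √(1−ℓ))) · ( x + √(x² + ℓ/(1−ℓ)) ) )^{1/(κ√(1−ℓ))}. Then f(1) = 1, f(x) > 0 for all x, and for every x ∈ ℝ the function log ∘ f is differentiable at x with derivative (d/dx) log f(x) = 1/(κ √(ℓ + (1−ℓ)x²)). -/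
theorem add_sqrt_sq_add_pos {c : ℝ} (hc : 0 < c) (x : ℝ) : 0 < x + √(x ^ 2 + c) := by
  have h : |x| < √(x ^ 2 + c) := Real.lt_sqrt_of_sq_lt (by rw [sq_abs]; linarith)
  linarith [neg_abs_le x]

theorem hasDerivAt_log_add_sqrt_sq_add {c : ℝ} (hc : 0 < c) (x : ℝ) :
    HasDerivAt (fun y => Real.log (y + √(y ^ 2 + c))) (1 / √(x ^ 2 + c)) x := by
  have hq : 0 < x ^ 2 + c := by positivity
  have hr : 0 < √(x ^ 2 + c) := Real.sqrt_pos.2 hq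
  have hp := add_sqrt_sq_add_pos hc x
  have hsq : HasDerivAt (fun y : ℝ => y ^ 2 + c) (2 * x) x := by
    simpa using (hasDerivAt_pow 2 x).add_const c
  have hsum : HasDerivAt (fun y : ℝ => y + √(y ^ 2 + c)) (1 + 2 * x / (2 * √(x ^ 2 + c))) x :=
    (hasDerivAt_id' x).add (hsq.sqrt hq.ne')
  refine (hsum.log hp.ne').congr_deriv ?_
  field_simp
  ring


/-- The conformal coordinate function on the degenerating cylinder: with
`f(x) = ((√(1-ℓ)/(1+√(1-ℓ)))(x + √(x² + ℓ/(1-ℓ))))^{1/(κ√(1-ℓ))}` one has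
`f(1) = 1`, `f > 0`, and `(log f)'(x) = 1/(κ√(ℓ+(1-ℓ)x²))`. -/
theorem stmt8 (κ ℓ : ℝ) (hκ : 0 < κ) (hℓ0 : 0 < ℓ) (hℓ1 : ℓ < 1) (f : ℝ → ℝ)
    (hf : ∀ x : ℝ, f x =
      (Real.sqrt (1 - ℓ) / (1 + Real.sqrt (1 - ℓ)) *
          (x + Real.sqrt (x ^ 2 + ℓ / (1 - ℓ)))) ^ (1 / (κ * Real.sqrt (1 - ℓ)))) :
    f 1 = 1 ∧ (∀ x : ℝ, 0 < f x) ∧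
      ∀ x : ℝ, HasDerivAt (fun y => Real.log (f y))
        (1 / (κ * Real.sqrt (ℓ + (1 - ℓ) * x ^ 2))) x := by
  have hd : 0 < 1 - ℓ := by linarith
  have hc : 0 < ℓ / (1 - ℓ) := div_pos hℓ0 hd
  have hs : 0 < √(1 - ℓ) := Real.sqrt_pos.2 hd
  have hA : 0 < √(1 - ℓ) / (1 + √(1 - ℓ)) := by positivity
  have hp := add_sqrt_sq_add_pos hc
  refine ⟨?_, fun x => ?_, fun x => ?_⟩
  · have h1 : (1 : ℝ) ^ 2 + ℓ / (1 - ℓ) = (1 - ℓ)⁻¹ := by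
      field_simp
      ring
    have h2 : √(1 - ℓ) / (1 + √(1 - ℓ)) * (1 + (√(1 - ℓ))⁻¹) = 1 := by
      field_simp
      ring
    rw [hf, h1, Real.sqrt_inv, h2, Real.one_rpow]
  · rw [hf]
    exact Real.rpow_pos_of_pos (mul_pos hA (hp x)) _
  · have hlog : (fun y => Real.log (f y)) = fun y => 1 / (κ * √(1 - ℓ)) *
        (Real.log (√(1 - ℓ) / (1 + √(1 - ℓ))) + Real.log (y + √(y ^ 2 + ℓ / (1 - ℓ)))) := by
      funext y
      rw [hf, Real.log_rpow (mul_pos hA (hp y)), Real.log_mul hA.ne' (hp y).ne']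
    have hsqrt : √(ℓ + (1 - ℓ) * x ^ 2) = √(1 - ℓ) * √(x ^ 2 + ℓ / (1 - ℓ)) := by
      rw [← Real.sqrt_mul hd.le]
      congr 1
      field_simp
      ring
    rw [hlog, hsqrt]
    refine (((hasDerivAt_log_add_sqrt_sq_add hc x).const_add _).const_mul _).congr_deriv ?_
    rw [one_div_mul_one_div, mul_assoc]
end

section
/- Let m, n ≥ 1 be natural numbers, let φ : ℝ^m → ℝ^n be continuously differentiable, let α > 1 be real, and let x ∈ ℝ^m be a point with φ(x) ≠ 0. Then at x the following pointwise inequality holds: ∑_{i=1}^m ⟨∂_i(|φ|^{2α−2} φ)(x), ∂_i φ(x)⟩ ≥ ((2α−1)/α²) ∑_{i=1}^m (∂_i(|φ|^α)(x))², where ⟨·,·⟩ is the Euclidean inner product on ℝ^n, |φ| is the Euclidean norm of φ, and ∂_i denotes the i-th partial derivative. -/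
open scoped RealInnerProductSpace

theorem HasFDerivAt.norm_rpow_of_ne_zero {E F : Type*} [NormedAddCommGroup E] [NormedSpace ℝ E]
    [NormedAddCommGroup F] [InnerProductSpace ℝ F] {f : E → F} {f' : E →L[ℝ] F} {x : E}
    (hf : HasFDerivAt f f' x) (hx : f x ≠ 0) (p : ℝ) :
    HasFDerivAt (fun y => ‖f y‖ ^ p) ((p * ‖f x‖ ^ (p - 2)) • (innerSL ℝ (f x)).comp f') x := by
  have hsq : ∀ (z : F) (q : ℝ), (‖z‖ ^ 2) ^ q = ‖z‖ ^ (2 * q) := fun z q => by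
    rw [← Real.rpow_natCast, ← Real.rpow_mul (norm_nonneg z)]
    norm_num
  have h := hf.norm_sq.rpow_const (p := p / 2) (Or.inl (by positivity))
  simp only [hsq] at h
  convert h using 1
  · ext y
    congr 1
    ring
  · rw [← Nat.cast_smul_eq_nsmul ℝ, smul_smul, show 2 * (p / 2 - 1) = p - 2 by ring]
    congr 1
    push_cast
    ring

/-- The directional form of the estimate: it holds along every single direction `v`. -/
theorem mul_sq_fderiv_norm_rpow_le_inner {E F : Type*} [NormedAddCommGroup E] [NormedSpace ℝ E]
    [NormedAddCommGroup F] [InnerProductSpace ℝ F] {f : E → F} {x : E}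
    (hf : DifferentiableAt ℝ f x) (hx : f x ≠ 0) {α : ℝ} (hα : α ≠ 0) (v : E) :
    ((2 * α - 1) / α ^ 2) * (fderiv ℝ (fun y => ‖f y‖ ^ α) x v) ^ 2 ≤
      ⟪fderiv ℝ (fun y => ‖f y‖ ^ (2 * α - 2) • f y) x v, fderiv ℝ f x v⟫ := by
  have hd := hf.hasFDerivAt
  rw [(hd.norm_rpow_of_ne_zero hx α).fderiv,
    ((hd.norm_rpow_of_ne_zero hx (2 * α - 2)).fun_smul hd).fderiv]
  have hr : 0 < ‖f x‖ := norm_pos_iff.mpr hx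
  have hsq : (‖f x‖ ^ (α - 2)) ^ 2 = ‖f x‖ ^ (2 * α - 2 - 2) := by
    rw [← Real.rpow_natCast, ← Real.rpow_mul hr.le]
    congr 1
    push_cast
    ring
  have hmul : ‖f x‖ ^ (2 * α - 2) = ‖f x‖ ^ (2 * α - 2 - 2) * ‖f x‖ ^ 2 := by
    rw [← Real.rpow_natCast, ← Real.rpow_add hr]
    congr 1
    push_cast
    ring
  simp only [add_apply, smul_apply,
    ContinuousLinearMap.smulRight_apply, ContinuousLinearMap.comp_apply, innerSL_apply_apply,
    inner_add_left, real_inner_smul_left, smul_eq_mul, real_inner_self_eq_norm_sq]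
  set w := fderiv ℝ f x v
  have hcs : ⟪f x, w⟫ ^ 2 ≤ ‖f x‖ ^ 2 * ‖w‖ ^ 2 := by
    rw [← mul_pow]
    exact sq_le_sq.mpr ((abs_real_inner_le_norm _ _).trans (le_abs_self _))
  have hlhs : (2 * α - 1) / α ^ 2 * (α * ‖f x‖ ^ (α - 2) * ⟪f x, w⟫) ^ 2 =
      (2 * α - 1) * (‖f x‖ ^ (2 * α - 2 - 2) * ⟪f x, w⟫ ^ 2) := by
    rw [← hsq]
    field_simp
  rw [hlhs, hmul]
  have := mul_le_mul_of_nonneg_left hcs (Real.rpow_nonneg hr.le (2 * α - 2 - 2))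
  linarith

/-- The Euclidean form of the key estimate (Lemma 4.3): for `α > 1` and `φ(x) ≠ 0`,
`∑ᵢ ⟨∂ᵢ(|φ|^{2α-2}φ), ∂ᵢφ⟩ ≥ ((2α-1)/α²) ∑ᵢ (∂ᵢ|φ|^α)²` at `x`. -/
theorem stmt11 (m n : ℕ) (hm : 1 ≤ m) (hn : 1 ≤ n)
    (φ : EuclideanSpace ℝ (Fin m) → EuclideanSpace ℝ (Fin n))
    (hφ : ContDiff ℝ 1 φ) (α : ℝ) (hα : 1 < α)
    (x : EuclideanSpace ℝ (Fin m)) (hx : φ x ≠ 0) :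
    ((2 * α - 1) / α ^ 2) *
        ∑ i : Fin m,
          (fderiv ℝ (fun y => ‖φ y‖ ^ α) x (EuclideanSpace.single i 1)) ^ 2 ≤
      ∑ i : Fin m,
        ⟪fderiv ℝ (fun y => ‖φ y‖ ^ (2 * α - 2) • φ y) x (EuclideanSpace.single i 1),
          fderiv ℝ φ x (EuclideanSpace.single i 1)⟫ := by
  rw [Finset.mul_sum]
  exact Finset.sum_le_sum fun i _ => mul_sq_fderiv_norm_rpow_le_inner
    (hφ.differentiable one_ne_zero x) hx (by positivity) _
end
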